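/- arXiv:1905.03950 — 7 statements merged into one kernel-verified Lean document; each statement's English description precedes it below -/
import Mathlib

section
/- Let C ∈ ℝ^{n×n}, ε > 0, and let p, q ∈ P_n have all entries strictly positive. Then the unique minimizer T*_ε of J_ε over S(p,q) has all entries strictly positive. -/
open Matrix BigOperators Filter

/-- `p` is a probability vector: nonnegative entries summing to 1. -/
def IsProbVec {n : ℕ} (p : Fin n → ℝ) : Prop :=
  (∀ j, 0 ≤ p j) ∧ ∑ j, p j = 1

/-- The transportation polytope `S(p,q)`: entrywise-nonnegative matrices with
row sums `p` and column sums `q`. -/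
def transportPolytope {n : ℕ} (p q : Fin n → ℝ) :
    Set (Matrix (Fin n) (Fin n) ℝ) :=
  {T | (∀ i j, 0 ≤ T i j) ∧ (∀ i, ∑ j, T i j = p i) ∧ (∀ j, ∑ i, T i j = q j)}

/-- Frobenius inner product on `n × n` real matrices. -/
def frobInner {n : ℕ} (A B : Matrix (Fin n) (Fin n) ℝ) : ℝ :=
  ∑ i, ∑ j, A i j * B i j

/-- Entropy-regularized transport objective
`J_ε(T) = ⟨C,T⟩ + ε Σ_{ij} T_{ij} (log T_{ij} - 1)`
(with `Real.log 0 = 0`, so the convention `0·(log 0 − 1) = 0` holds). -/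
noncomputable def entObj {n : ℕ} (C : Matrix (Fin n) (Fin n) ℝ) (ε : ℝ)
    (T : Matrix (Fin n) (Fin n) ℝ) : ℝ :=
  frobInner C T + ε * ∑ i, ∑ j, T i j * (Real.log (T i j) - 1)

/-- The entropy integrand `x (log x - 1)` is convex on the nonnegative reals. -/
lemma convexOn_mul_log_sub_one :
    ConvexOn ℝ (Set.Ici 0) fun x : ℝ => x * (Real.log x - 1) := by
  refine (Real.convexOn_mul_log.sub (concaveOn_id (convex_Ici 0))).congr fun x _ => ?_
  simp only [Pi.sub_apply, id]
  ring

/-- The outer product of two probability vectors lies in their transportation polytope. -/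
lemma vecMulVec_mem_transportPolytope {n : ℕ} {p q : Fin n → ℝ}
    (hp : IsProbVec p) (hq : IsProbVec q) :
    vecMulVec p q ∈ transportPolytope p q := by
  refine ⟨fun i j => mul_nonneg (hp.1 i) (hq.1 j), fun i => ?_, fun j => ?_⟩
  · simp [vecMulVec_apply, ← Finset.mul_sum, hq.2]
  · simp [vecMulVec_apply, ← Finset.sum_mul, hp.2]

lemma convex_transportPolytope {n : ℕ} (p q : Fin n → ℝ) :
    Convex ℝ (transportPolytope p q) := by
  intro T hT U hU a b ha hb hab
  refine ⟨fun i j => ?_, fun i => ?_, fun j => ?_⟩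
  · exact add_nonneg (mul_nonneg ha (hT.1 i j)) (mul_nonneg hb (hU.1 i j))
  · simp [Finset.sum_add_distrib, ← Finset.mul_sum, hT.2.1, hU.2.1, ← add_mul, hab]
  · simp [Finset.sum_add_distrib, ← Finset.mul_sum, hT.2.2, hU.2.2, ← add_mul, hab]

lemma entObj_eq_sum {n : ℕ} (C : Matrix (Fin n) (Fin n) ℝ) (ε : ℝ)
    (T : Matrix (Fin n) (Fin n) ℝ) :
    entObj C ε T = ∑ i, ∑ j, (C i j * T i j + ε * (T i j * (Real.log (T i j) - 1))) := by
  simp [entObj, frobInner, Finset.sum_add_distrib, Finset.mul_sum]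

/-- Convexity of the objective, improved by `ε t U_{ab} log t` when `T_{ab} = 0`. -/
lemma entObj_segment_le {n : ℕ} (C : Matrix (Fin n) (Fin n) ℝ) {ε : ℝ} (hε : 0 ≤ ε)
    {T U : Matrix (Fin n) (Fin n) ℝ} (hT : ∀ i j, 0 ≤ T i j) (hU : ∀ i j, 0 ≤ U i j)
    {a b : Fin n} (hTab : T a b = 0) (hUab : U a b ≠ 0) {t : ℝ} (ht : 0 < t) (ht1 : t ≤ 1) :
    entObj C ε ((1 - t) • T + t • U) ≤
      (1 - t) * entObj C ε T + t * entObj C ε U + ε * (t * U a b * Real.log t) := by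
  have hsum : ε * (t * U a b * Real.log t) =
      ∑ i, ∑ j, if i = a then if j = b then ε * (t * U a b * Real.log t) else 0 else 0 := by
    simp
  rw [hsum]
  simp only [entObj_eq_sum, Finset.mul_sum, ← Finset.sum_add_distrib]
  refine Finset.sum_le_sum fun i _ => Finset.sum_le_sum fun j _ => ?_
  simp only [Matrix.add_apply, Matrix.smul_apply, smul_eq_mul]
  by_cases h : i = a ∧ j = b
  · obtain ⟨rfl, rfl⟩ := h
    simp only [hTab, if_true, mul_zero, zero_mul, zero_add, add_zero,
      Real.log_mul ht.ne' hUab]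
    apply le_of_eq
    ring
  · have hite : (if i = a then if j = b then ε * (t * U a b * Real.log t) else 0 else 0) = 0 := by
      grind
    rw [hite]
    have hconv := convexOn_mul_log_sub_one.2 (hT i j) (hU i j) (sub_nonneg.2 ht1) ht.le
      (sub_add_cancel 1 t)
    simp only [smul_eq_mul] at hconv
    linarith [mul_le_mul_of_nonneg_left hconv hε]

/-- if `p` and `q` have strictly positive entries, then the
(unique) minimizer of `J_ε` over `S(p,q)` has strictly positive entries. -/
theorem entropic_minimizer_pos {n : ℕ} (C : Matrix (Fin n) (Fin n) ℝ)
    (ε : ℝ) (hε : 0 < ε) (p q : Fin n → ℝ)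
    (hp : IsProbVec p) (hq : IsProbVec q)
    (hppos : ∀ i, 0 < p i) (hqpos : ∀ j, 0 < q j)
    (Tstar : Matrix (Fin n) (Fin n) ℝ)
    (hmem : Tstar ∈ transportPolytope p q)
    (hmin : ∀ T ∈ transportPolytope p q, entObj C ε Tstar ≤ entObj C ε T) :
    ∀ i j, 0 < Tstar i j := by
  intro a b
  by_contra hab
  have hTab : Tstar a b = 0 := le_antisymm (not_lt.1 hab) (hmem.1 a b)
  set U := vecMulVec p q
  have hU : U ∈ transportPolytope p q := vecMulVec_mem_transportPolytope hp hq
  have hUab : 0 < U a b := mul_pos (hppos a) (hqpos b)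
  set D := entObj C ε U - entObj C ε Tstar
  have hD : 0 ≤ D := sub_nonneg.2 (hmin U hU)
  have hεU : 0 < ε * U a b := mul_pos hε hUab
  set t := Real.exp (-((D + 1) / (ε * U a b)))
  have ht : 0 < t := Real.exp_pos _
  have ht1 : t ≤ 1 := Real.exp_le_one_iff.2 (neg_nonpos.2 (by positivity))
  have hlog : ε * U a b * Real.log t = -(D + 1) := by
    rw [Real.log_exp]
    field_simp
  have hle := (hmin _ (convex_transportPolytope p q hmem hU (sub_nonneg.2 ht1) ht.le
    (sub_add_cancel 1 t))).trans (entObj_segment_le C hε.le hmem.1 hU.1 hTab hUab.ne' ht ht1)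
  have hneg : (1 - t) * entObj C ε Tstar + t * entObj C ε U + ε * (t * U a b * Real.log t) =
      entObj C ε Tstar - t := by
    linear_combination t * hlog
  linarith
end

section
/- Let C ∈ ℝ^{n×n}, ε > 0, let K be the Gibbs kernel K_{ij} = exp(−C_{ij}/ε), and let p, q ∈ P_n have all entries strictly positive. Then the unique minimizer T*_ε of J_ε over S(p,q) has the diagonal-scaling form (T*_ε)_{ij} = a_i K_{ij} b_j for some vectors a, b ∈ ℝ^n with all entries strictly positive. -/
open Matrix BigOperators Filter

/-- The contribution to the entropic objective of an entry `x` with cost `c`. -/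
noncomputable def entTerm (c ε x : ℝ) : ℝ := c * x + ε * (x * (Real.log x - 1))

lemma entObj_eq_sum_entTerm {n : ℕ} (C : Matrix (Fin n) (Fin n) ℝ) (ε : ℝ)
    (T : Matrix (Fin n) (Fin n) ℝ) :
    entObj C ε T = ∑ i, ∑ j, entTerm (C i j) ε (T i j) := by
  simp only [entObj, frobInner, entTerm, Finset.sum_add_distrib, Finset.mul_sum]

lemma entTerm_segment_le {c ε x y t : ℝ} (hε : 0 < ε) (hx : 0 ≤ x) (hy : 0 ≤ y)
    (ht : 0 ≤ t) (ht1 : t ≤ 1) :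
    entTerm c ε ((1 - t) * x + t * y) ≤ (1 - t) * entTerm c ε x + t * entTerm c ε y := by
  have h := Real.convexOn_mul_log.2 (Set.mem_Ici.2 hx) (Set.mem_Ici.2 hy)
    (sub_nonneg.2 ht1) ht (by ring)
  simp only [smul_eq_mul] at h
  have h' := mul_le_mul_of_nonneg_left h hε.le
  simp only [entTerm]
  linarith

lemma entTerm_mul {c ε y t : ℝ} (hy : 0 < y) (ht : 0 < t) :
    entTerm c ε (t * y) = t * entTerm c ε y + ε * t * y * Real.log t := by
  simp only [entTerm, Real.log_mul ht.ne' hy.ne']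
  ring

lemma hasDerivAt_entTerm_line {c ε x d : ℝ} (hx : x ≠ 0) :
    HasDerivAt (fun s : ℝ => entTerm c ε (x + s * d)) ((c + ε * Real.log x) * d) 0 := by
  have hline : HasDerivAt (fun s : ℝ => x + s * d) d 0 := by
    simpa using ((hasDerivAt_id (0 : ℝ)).mul_const d).const_add x
  have hlog := hline.log (by simpa using hx)
  have h := (hline.const_mul c).add ((hline.mul (hlog.sub_const 1)).const_mul ε)
  refine h.congr_deriv ?_
  simp only [zero_mul, add_zero]
  field_simp
  ring

lemma transportPolytope_segment_mem {n : ℕ} {p q : Fin n → ℝ}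
    {A B : Matrix (Fin n) (Fin n) ℝ} (hA : A ∈ transportPolytope p q)
    (hB : B ∈ transportPolytope p q) {t : ℝ} (ht : 0 ≤ t) (ht1 : t ≤ 1) :
    (1 - t) • A + t • B ∈ transportPolytope p q := by
  refine ⟨fun i j => add_nonneg (mul_nonneg (sub_nonneg.2 ht1) (hA.1 i j))
    (mul_nonneg ht (hB.1 i j)), fun i => ?_, fun j => ?_⟩
  · simp only [Matrix.add_apply, Matrix.smul_apply, smul_eq_mul, Finset.sum_add_distrib,
      ← Finset.mul_sum, hA.2.1, hB.2.1]
    ring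
  · simp only [Matrix.add_apply, Matrix.smul_apply, smul_eq_mul, Finset.sum_add_distrib,
      ← Finset.mul_sum, hA.2.2, hB.2.2]
    ring

/-- If the polytope has an entrywise-positive element, minimizers are entrywise positive. -/
lemma pos_of_entObj_minimizer {n : ℕ} {C : Matrix (Fin n) (Fin n) ℝ} {ε : ℝ} (hε : 0 < ε)
    {p q : Fin n → ℝ} {T S : Matrix (Fin n) (Fin n) ℝ} (hT : T ∈ transportPolytope p q)
    (hmin : ∀ R ∈ transportPolytope p q, entObj C ε T ≤ entObj C ε R)
    (hS : S ∈ transportPolytope p q) (hSpos : ∀ i j, 0 < S i j) (i j : Fin n) :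
    0 < T i j := by
  refine (hT.1 i j).lt_of_ne' fun h0 => ?_
  have key : ∀ t : ℝ, 0 < t → t ≤ 1 →
      0 ≤ entObj C ε S - entObj C ε T + ε * S i j * Real.log t := by
    intro t ht ht1
    have hle := hmin _ (transportPolytope_segment_mem hT hS ht.le ht1)
    have hub : entObj C ε ((1 - t) • T + t • S) ≤
        ∑ k, ∑ l, ((1 - t) * entTerm (C k l) ε (T k l) + t * entTerm (C k l) ε (S k l) +
          if k = i then if l = j then ε * t * S i j * Real.log t else 0 else 0) := by
      rw [entObj_eq_sum_entTerm]
      refine Finset.sum_le_sum fun k _ => Finset.sum_le_sum fun l _ => ?_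
      simp only [Matrix.add_apply, Matrix.smul_apply, smul_eq_mul]
      by_cases hkl : k = i ∧ l = j
      · obtain ⟨rfl, rfl⟩ := hkl
        rw [h0, mul_zero, zero_add, entTerm_mul (hSpos k l) ht]
        simp [entTerm]
      · have hif : (if k = i then if l = j then ε * t * S i j * Real.log t else 0 else 0) = 0 := by
          split_ifs <;> tauto
        rw [hif, add_zero]
        exact entTerm_segment_le hε (hT.1 k l) (hS.1 k l) ht.le ht1
    have hsum : ∑ k, ∑ l, ((1 - t) * entTerm (C k l) ε (T k l) + t * entTerm (C k l) ε (S k l) +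
          if k = i then if l = j then ε * t * S i j * Real.log t else 0 else 0) =
        (1 - t) * entObj C ε T + t * entObj C ε S + ε * t * S i j * Real.log t := by
      simp only [Finset.sum_add_distrib, ← Finset.mul_sum, ← entObj_eq_sum_entTerm]
      congr 1
      rw [Finset.sum_eq_single i (fun k _ hk => by simp [hk]) (by simp)]
      simp
    rw [hsum] at hub
    have h : 0 ≤ t * (entObj C ε S - entObj C ε T + ε * S i j * Real.log t) := by linarith
    exact nonneg_of_mul_nonneg_right h ht
  have hb : 0 < ε * S i j := mul_pos hε (hSpos i j)
  have hD : entObj C ε T ≤ entObj C ε S := hmin S hS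
  have h := key (Real.exp (-((entObj C ε S - entObj C ε T + 1) / (ε * S i j))))
    (Real.exp_pos _) (Real.exp_le_one_iff.2 (neg_nonpos.2 (div_nonneg (by linarith) hb.le)))
  rw [Real.log_exp, mul_neg, mul_div_cancel₀ _ hb.ne'] at h
  linarith

/-- First-order optimality: at an entrywise-positive minimizer, the gradient is orthogonal to
every direction preserving the marginals. -/
lemma sum_gradient_mul_eq_zero {n : ℕ} {C : Matrix (Fin n) (Fin n) ℝ} {ε : ℝ}
    {p q : Fin n → ℝ} {T D : Matrix (Fin n) (Fin n) ℝ} (hT : T ∈ transportPolytope p q)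
    (hmin : ∀ R ∈ transportPolytope p q, entObj C ε T ≤ entObj C ε R)
    (hpos : ∀ i j, 0 < T i j) (hrow : ∀ i, ∑ j, D i j = 0) (hcol : ∀ j, ∑ i, D i j = 0) :
    ∑ i, ∑ j, (C i j + ε * Real.log (T i j)) * D i j = 0 := by
  have hder : HasDerivAt (fun s : ℝ => entObj C ε (T + s • D))
      (∑ i, ∑ j, (C i j + ε * Real.log (T i j)) * D i j) 0 := by
    simp only [entObj_eq_sum_entTerm, Matrix.add_apply, Matrix.smul_apply, smul_eq_mul]
    exact HasDerivAt.fun_sum fun i _ => HasDerivAt.fun_sum fun j _ =>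
      hasDerivAt_entTerm_line (hpos i j).ne'
  refine IsLocalMin.hasDerivAt_eq_zero ?_ hder
  have hev : ∀ᶠ s : ℝ in nhds 0, ∀ i j, 0 < T i j + s * D i j := by
    refine eventually_all.2 fun i => eventually_all.2 fun j => ?_
    have hc : ContinuousAt (fun s : ℝ => T i j + s * D i j) 0 := by fun_prop
    exact hc.eventually (lt_mem_nhds (by simpa using hpos i j))
  filter_upwards [hev] with s hs
  simp only [zero_smul, add_zero]
  refine hmin _ ⟨fun i j => (hs i j).le, fun i => ?_, fun j => ?_⟩
  · simp only [Matrix.add_apply, Matrix.smul_apply, smul_eq_mul]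
    rw [Finset.sum_add_distrib, ← Finset.mul_sum, hrow, hT.2.1, mul_zero, add_zero]
  · simp only [Matrix.add_apply, Matrix.smul_apply, smul_eq_mul]
    rw [Finset.sum_add_distrib, ← Finset.mul_sum, hcol, hT.2.2, mul_zero, add_zero]

lemma sum_mul_vecMulVec_single_sub_single {n : ℕ} (G : Matrix (Fin n) (Fin n) ℝ) (i k j l : Fin n) :
    ∑ a, ∑ b, G a b * vecMulVec (Pi.single i 1 - Pi.single k 1)
      (Pi.single j 1 - Pi.single l 1) a b =
      G i j - G i l - (G k j - G k l) := by
  simp [vecMulVec_apply, Pi.single_apply, mul_sub, Finset.sum_sub_distrib]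
  ring

/-- if `p` and `q` have strictly positive entries, the (unique)
minimizer of `J_ε` over `S(p,q)` is of the diagonal-scaling form
`T_{ij} = a_i K_{ij} b_j` with `K` the Gibbs kernel and `a, b` entrywise
positive. -/
theorem entropic_minimizer_diagonal_scaling {n : ℕ}
    (C K : Matrix (Fin n) (Fin n) ℝ) (ε : ℝ) (hε : 0 < ε)
    (hK : ∀ i j, K i j = Real.exp (-(C i j) / ε))
    (p q : Fin n → ℝ) (hp : IsProbVec p) (hq : IsProbVec q)
    (hppos : ∀ i, 0 < p i) (hqpos : ∀ j, 0 < q j)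
    (Tstar : Matrix (Fin n) (Fin n) ℝ)
    (hmem : Tstar ∈ transportPolytope p q)
    (hmin : ∀ T ∈ transportPolytope p q, entObj C ε Tstar ≤ entObj C ε T) :
    ∃ a b : Fin n → ℝ, (∀ i, 0 < a i) ∧ (∀ j, 0 < b j) ∧
      ∀ i j, Tstar i j = a i * K i j * b j := by
  have hpos := pos_of_entObj_minimizer hε hmem hmin (vecMulVec_mem_transportPolytope hp hq)
    fun i j => mul_pos (hppos i) (hqpos j)
  have hn : Nonempty (Fin n) := by
    by_contra hne
    have := not_nonempty_iff.1 hne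
    simpa using hp.2
  obtain ⟨o⟩ := hn
  let G : Matrix (Fin n) (Fin n) ℝ := of fun i j => C i j + ε * Real.log (Tstar i j)
  have hexch : ∀ i j, G i j = G i o + (G o j - G o o) := by
    intro i j
    have h := sum_gradient_mul_eq_zero (D := vecMulVec (Pi.single i 1 - Pi.single o 1)
      (Pi.single j 1 - Pi.single o 1)) hmem hmin hpos
      (fun a => by simp [vecMulVec_apply, ← Finset.mul_sum])
      (fun b => by simp [vecMulVec_apply, ← Finset.sum_mul])
    have h' := (sum_mul_vecMulVec_single_sub_single G i o j o).symm.trans h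
    linarith
  refine ⟨fun i => Real.exp (G i o / ε), fun j => Real.exp ((G o j - G o o) / ε),
    fun i => Real.exp_pos _, fun j => Real.exp_pos _, fun i j => ?_⟩
  rw [hK, ← Real.exp_add, ← Real.exp_add]
  have hexp : G i o / ε + -(C i j) / ε + (G o j - G o o) / ε = Real.log (Tstar i j) := by
    have h := hexch i j
    have hGij : G i j = C i j + ε * Real.log (Tstar i j) := rfl
    rw [← add_div, ← add_div, div_eq_iff hε.ne']
    linarith
  rw [hexp, Real.exp_log (hpos i j)]
end

section
/- Let C ∈ ℝ^{n×n}, ε > 0, let K be the Gibbs kernel K_{ij} = exp(−C_{ij}/ε), and let p, q ∈ P_n. If a, b ∈ ℝ^n have all entries strictly positive and the matrix T defined by T_{ij} = a_i K_{ij} b_j belongs to S(p,q), then T is the unique minimizer of J_ε over S(p,q). -/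
open Matrix BigOperators Filter

/-- The Bregman remainder of `x ↦ x (log x - 1)` at a positive point `t`, expressed through
the Kullback–Leibler function. -/
lemma mul_log_sub_one_eq_add_klFun {x t : ℝ} (ht : 0 < t) :
    x * (Real.log x - 1) = t * (Real.log t - 1) + Real.log t * (x - t)
      + t * InformationTheory.klFun (x / t) := by
  rcases eq_or_ne x 0 with rfl | hx
  · simp only [InformationTheory.klFun, zero_div, zero_mul]
    ring
  · rw [InformationTheory.klFun, Real.log_div hx ht.ne']
    field_simp
    ring

/-- A potential of the form `f i + g j` has the same integral against all couplings of `p`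
and `q`. -/
lemma sum_add_mul_sub_eq_zero_of_mem_transportPolytope {n : ℕ} {p q : Fin n → ℝ}
    {T X : Matrix (Fin n) (Fin n) ℝ} (hT : T ∈ transportPolytope p q)
    (hX : X ∈ transportPolytope p q) (f g : Fin n → ℝ) :
    ∑ i, ∑ j, (f i + g j) * (X i j - T i j) = 0 := by
  have hf : ∑ i, ∑ j, f i * (X i j - T i j) = 0 := by
    simp only [← Finset.mul_sum, Finset.sum_sub_distrib, hX.2.1, hT.2.1, sub_self, mul_zero,
      Finset.sum_const_zero]
  have hg : ∑ i, ∑ j, g j * (X i j - T i j) = 0 := by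
    rw [Finset.sum_comm]
    simp only [← Finset.mul_sum, Finset.sum_sub_distrib, hX.2.2, hT.2.2, sub_self, mul_zero,
      Finset.sum_const_zero]
  simp only [add_mul, Finset.sum_add_distrib, hf, hg, add_zero]

/-- If the cost is `ε (f i + g j - log T i j)`, then the objective on the polytope exceeds its
value at `T` by `ε` times the generalized Kullback–Leibler divergence from `T`. -/
lemma entObj_eq_add_klFun {n : ℕ} {C T X : Matrix (Fin n) (Fin n) ℝ} {ε : ℝ}
    {p q f g : Fin n → ℝ} (hpos : ∀ i j, 0 < T i j)
    (hC : ∀ i j, C i j = ε * (f i + g j - Real.log (T i j)))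
    (hT : T ∈ transportPolytope p q) (hX : X ∈ transportPolytope p q) :
    entObj C ε X = entObj C ε T
      + ε * ∑ i, ∑ j, T i j * InformationTheory.klFun (X i j / T i j) := by
  have h0 := sum_add_mul_sub_eq_zero_of_mem_transportPolytope hT hX f g
  rw [← add_zero (_ + _), ← mul_zero ε, ← h0]
  simp only [entObj, frobInner, Finset.mul_sum, ← Finset.sum_add_distrib]
  refine Finset.sum_congr rfl fun i _ => Finset.sum_congr rfl fun j _ => ?_
  rw [mul_log_sub_one_eq_add_klFun (x := X i j) (hpos i j), hC]
  ring

/-- if `T_{ij} = a_i K_{ij} b_j` with `a, b` entrywise positive,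
`K` the Gibbs kernel, and `T ∈ S(p,q)`, then `T` is the unique minimizer of
`J_ε` over `S(p,q)`. -/
theorem diagonal_scaling_is_unique_minimizer {n : ℕ}
    (C K : Matrix (Fin n) (Fin n) ℝ) (ε : ℝ) (hε : 0 < ε)
    (hK : ∀ i j, K i j = Real.exp (-(C i j) / ε))
    (p q : Fin n → ℝ) (hp : IsProbVec p) (hq : IsProbVec q)
    (a b : Fin n → ℝ) (ha : ∀ i, 0 < a i) (hb : ∀ j, 0 < b j)
    (T : Matrix (Fin n) (Fin n) ℝ) (hT : ∀ i j, T i j = a i * K i j * b j)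
    (hmem : T ∈ transportPolytope p q) :
    (∀ T' ∈ transportPolytope p q, entObj C ε T ≤ entObj C ε T') ∧
      (∀ T' ∈ transportPolytope p q,
        (∀ T'' ∈ transportPolytope p q, entObj C ε T' ≤ entObj C ε T'') →
          T' = T) := by
  have hpos : ∀ i j, 0 < T i j := fun i j => by
    rw [hT, hK]
    exact mul_pos (mul_pos (ha i) (Real.exp_pos _)) (hb j)
  have hC : ∀ i j, C i j = ε * (Real.log (a i) + Real.log (b j) - Real.log (T i j)) := by
    intro i j
    rw [hT, hK, Real.log_mul (mul_pos (ha i) (Real.exp_pos _)).ne' (hb j).ne',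
      Real.log_mul (ha i).ne' (Real.exp_pos _).ne', Real.log_exp]
    field_simp
    ring
  have hterm : ∀ X ∈ transportPolytope p q, ∀ i j,
      0 ≤ T i j * InformationTheory.klFun (X i j / T i j) := fun X hX i j =>
    mul_nonneg (hpos i j).le
      (InformationTheory.klFun_nonneg (div_nonneg (hX.1 i j) (hpos i j).le))
  have hrow : ∀ X ∈ transportPolytope p q, ∀ i,
      0 ≤ ∑ j, T i j * InformationTheory.klFun (X i j / T i j) := fun X hX i =>
    Finset.sum_nonneg fun j _ => hterm X hX i j
  refine ⟨fun X hX => ?_, fun X hX hmin => ?_⟩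
  · rw [entObj_eq_add_klFun hpos hC hmem hX]
    exact le_add_of_nonneg_right
      (mul_nonneg hε.le (Finset.sum_nonneg fun i _ => hrow X hX i))
  · have hle := hmin T hmem
    rw [entObj_eq_add_klFun hpos hC hmem hX, add_le_iff_nonpos_right] at hle
    have hzero : ∑ i, ∑ j, T i j * InformationTheory.klFun (X i j / T i j) = 0 :=
      le_antisymm (nonpos_of_mul_nonpos_right hle hε)
        (Finset.sum_nonneg fun i _ => hrow X hX i)
    ext i j
    have hi := (Finset.sum_eq_zero_iff_of_nonneg fun i _ => hrow X hX i).1 hzero i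
      (Finset.mem_univ i)
    have hij := (Finset.sum_eq_zero_iff_of_nonneg fun j _ => hterm X hX i j).1 hi j
      (Finset.mem_univ j)
    have hkl := (mul_eq_zero.1 hij).resolve_left (hpos i j).ne'
    rw [InformationTheory.klFun_eq_zero_iff (div_nonneg (hX.1 i j) (hpos i j).le)] at hkl
    exact (div_eq_one_iff_eq (hpos i j).ne').1 hkl
end

section
/- Let K ∈ ℝ^{n×n} have all entries strictly positive and let p, q ∈ P_n. If a, b, a′, b′ ∈ ℝ^n all have strictly positive entries and both matrices T and T′, defined by T_{ij} = a_i K_{ij} b_j and T′_{ij} = a′_i K_{ij} b′_j, belong to S(p,q), then T = T′; moreover there exists λ > 0 such that a′ = λ a and b′ = λ^{−1} b. -/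
open Matrix BigOperators Filter

/-- uniqueness of Sinkhorn diagonal scalings: two positive
diagonal scalings of an entrywise-positive `K` lying in the same `S(p,q)`
coincide, and the scaling vectors agree up to a positive scalar. -/
theorem sinkhorn_scaling_unique {n : ℕ} (K : Matrix (Fin n) (Fin n) ℝ)
    (hKpos : ∀ i j, 0 < K i j) (p q : Fin n → ℝ)
    (hp : IsProbVec p) (hq : IsProbVec q)
    (a b a' b' : Fin n → ℝ)
    (ha : ∀ i, 0 < a i) (hb : ∀ j, 0 < b j)
    (ha' : ∀ i, 0 < a' i) (hb' : ∀ j, 0 < b' j)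
    (T T' : Matrix (Fin n) (Fin n) ℝ)
    (hT : ∀ i j, T i j = a i * K i j * b j)
    (hT' : ∀ i j, T' i j = a' i * K i j * b' j)
    (hTmem : T ∈ transportPolytope p q)
    (hT'mem : T' ∈ transportPolytope p q) :
    T = T' ∧ ∃ lam : ℝ, 0 < lam ∧
      (∀ i, a' i = lam * a i) ∧ (∀ j, b' j = lam⁻¹ * b j) := by
  obtain ⟨-, hrow, hcol⟩ := hTmem
  obtain ⟨-, hrow', hcol'⟩ := hT'mem
  have hTpos : ∀ i j, 0 < T i j := fun i j ↦ by
    rw [hT]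
    exact mul_pos (mul_pos (ha i) (hKpos i j)) (hb j)
  set r : Fin n → ℝ := fun i ↦ a' i / a i with hr
  set s : Fin n → ℝ := fun j ↦ b' j / b j with hs
  have hspos : ∀ j, 0 < s j := fun j ↦ div_pos (hb' j) (hb j)
  have hdiff : ∀ i j, T' i j - T i j = T i j * (r i * s j - 1) := fun i j ↦ by
    have := (ha i).ne'
    have := (hb j).ne'
    rw [hT, hT', hr, hs]
    field_simp
  have hrow0 : ∀ i, ∑ j, T i j * (r i * s j - 1) = 0 := fun i ↦ by
    simp only [← hdiff, Finset.sum_sub_distrib, hrow, hrow', sub_self]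
  have hcol0 : ∀ j, ∑ i, T i j * (r i * s j - 1) = 0 := fun j ↦ by
    simp only [← hdiff, Finset.sum_sub_distrib, hcol, hcol', sub_self]
  have hne : Nonempty (Fin n) := by
    by_contra h
    rw [not_nonempty_iff] at h
    simpa using hp.2
  obtain ⟨i₀, hi₀⟩ := Finite.exists_max r
  obtain ⟨j₀, hj₀⟩ := Finite.exists_min s
  have hrpos : 0 < r i₀ := div_pos (ha' i₀) (ha i₀)
  have hcorner : 1 ≤ r i₀ * s j₀ := by
    by_contra! h
    refine (Finset.sum_neg (fun i _ ↦ mul_neg_of_pos_of_neg (hTpos i j₀) ?_)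
      Finset.univ_nonempty).ne (hcol0 j₀)
    linarith [mul_le_mul_of_nonneg_right (hi₀ i) (hspos j₀).le]
  have hs_eq : ∀ j, r i₀ * s j = 1 := fun j ↦ by
    have h := (Finset.sum_eq_zero_iff_of_nonneg (fun j _ ↦ mul_nonneg (hTpos i₀ j).le
      (by linarith [mul_le_mul_of_nonneg_left (hj₀ j) hrpos.le]))).1 (hrow0 i₀) j
      (Finset.mem_univ j)
    linarith [(mul_eq_zero.1 h).resolve_left (hTpos i₀ j).ne']
  have hrs : ∀ i j, r i * s j = 1 := fun i j ↦ by
    have h := (Finset.sum_eq_zero_iff_of_nonpos (fun i _ ↦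
      mul_nonpos_of_nonneg_of_nonpos (hTpos i j).le
      (by linarith [mul_le_mul_of_nonneg_right (hi₀ i) (hspos j).le, hs_eq j]))).1 (hcol0 j) i
      (Finset.mem_univ i)
    linarith [(mul_eq_zero.1 h).resolve_left (hTpos i j).ne']
  refine ⟨?_, r i₀, hrpos, fun i ↦ ?_, fun j ↦ ?_⟩
  · ext i j
    have h := hdiff i j
    rw [hrs, sub_self, mul_zero] at h
    linarith
  · have h : r i = r i₀ :=
      mul_right_cancel₀ (hspos j₀).ne' ((hrs i j₀).trans (hrs i₀ j₀).symm)
    rw [← h]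
    exact (div_mul_cancel₀ _ (ha i).ne').symm
  · rw [← eq_inv_of_mul_eq_one_right (hs_eq j)]
    exact (div_mul_cancel₀ _ (hb j).ne').symm
end

section
/- Let K ∈ ℝ^{n×n} have all entries strictly positive, and let p, q ∈ P_n have all entries strictly positive. Then there exist vectors a, b ∈ ℝ^n with all entries strictly positive such that the matrix T defined by T_{ij} = a_i K_{ij} b_j satisfies T·1 = p and Tᵀ·1 = q, i.e., T ∈ S(p,q). -/
open Matrix BigOperators Filter

/-- The convex potential (in logarithmic coordinates) whose critical points are the column
scalings of `K`. -/
noncomputable def sinkhornPotential {n : ℕ} (K : Matrix (Fin n) (Fin n) ℝ) (p q x : Fin n → ℝ) :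
    ℝ :=
  ∑ i, p i * Real.log (∑ j, K i j * x j) - ∑ j, q j * Real.log (x j)

lemma sum_mul_pos_of_mem_stdSimplex {ι : Type*} [Fintype ι] {k x : ι → ℝ}
    (hk : ∀ j, 0 < k j) (hx : x ∈ stdSimplex ℝ ι) : 0 < ∑ j, k j * x j := by
  have hnonneg : ∀ j ∈ Finset.univ, 0 ≤ k j * x j := fun j _ => mul_nonneg (hk j).le (hx.1 j)
  refine (Finset.sum_nonneg hnonneg).lt_of_ne' fun h => ?_
  rw [Finset.sum_eq_zero_iff_of_nonneg hnonneg] at h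
  have hzero : ∑ j, x j = 0 := Finset.sum_eq_zero fun j hj =>
    (mul_eq_zero.mp (h j hj)).resolve_left (hk j).ne'
  exact one_ne_zero (hx.2.symm.trans hzero)

lemma sinkhornPotential_smul {n : ℕ} [NeZero n] {K : Matrix (Fin n) (Fin n) ℝ}
    (hK : ∀ i j, 0 < K i j) {p q : Fin n → ℝ} (hp : IsProbVec p) (hq : IsProbVec q)
    {x : Fin n → ℝ} (hx : ∀ j, 0 < x j) {c : ℝ} (hc : 0 < c) :
    sinkhornPotential K p q (c • x) = sinkhornPotential K p q x := by
  have hrow : ∀ i, Real.log (∑ j, K i j * (c • x) j)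
      = Real.log c + Real.log (∑ j, K i j * x j) := fun i => by
    rw [← Real.log_mul hc.ne'
      (Finset.sum_pos (fun j _ => mul_pos (hK i j) (hx j)) Finset.univ_nonempty).ne',
      Finset.mul_sum]
    congr 1
    exact Finset.sum_congr rfl fun j _ => by simp only [Pi.smul_apply, smul_eq_mul]; ring
  have hcol : ∀ j, Real.log ((c • x) j) = Real.log c + Real.log (x j) := fun j =>
    Real.log_mul hc.ne' (hx j).ne'
  simp only [sinkhornPotential, hrow, hcol, mul_add, Finset.sum_add_distrib, ← Finset.sum_mul,
    hp.2, hq.2]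
  ring

lemma exists_sinkhornPotential_le {n : ℕ} [NeZero n] {K : Matrix (Fin n) (Fin n) ℝ}
    (hK : ∀ i j, 0 < K i j) {p q : Fin n → ℝ} (hp : IsProbVec p) (hq : IsProbVec q)
    (hqpos : ∀ j, 0 < q j) :
    ∃ x : Fin n → ℝ, (∀ j, 0 < x j) ∧ ∀ y : Fin n → ℝ, (∀ j, 0 < y j) →
      sinkhornPotential K p q x ≤ sinkhornPotential K p q y := by
  let G : (Fin n → ℝ) → ℝ := fun x => (∏ j, x j ^ q j) * ∏ i, (∑ j, K i j * x j) ^ (-p i)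
  have hGcont : ContinuousOn G (stdSimplex ℝ (Fin n)) := by
    refine ContinuousOn.mul ?_ ?_
    · exact continuousOn_finsetProd _ fun j _ =>
        ContinuousOn.rpow_const (by fun_prop) fun _ _ => Or.inr (hqpos j).le
    · exact continuousOn_finsetProd _ fun i _ =>
        ContinuousOn.rpow_const (by fun_prop) fun x hx =>
          Or.inl (sum_mul_pos_of_mem_stdSimplex (hK i) hx).ne'
  have hrow : ∀ {y : Fin n → ℝ}, (∀ j, 0 < y j) → ∀ i, 0 < ∑ j, K i j * y j := fun hy i =>
    Finset.sum_pos (fun j _ => mul_pos (hK i j) (hy j)) Finset.univ_nonempty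
  have hGpos : ∀ {y : Fin n → ℝ}, (∀ j, 0 < y j) → 0 < G y := fun hy =>
    mul_pos (Finset.prod_pos fun j _ => Real.rpow_pos_of_pos (hy j) _)
      (Finset.prod_pos fun i _ => Real.rpow_pos_of_pos (hrow hy i) _)
  have hGlog : ∀ {y : Fin n → ℝ}, (∀ j, 0 < y j) →
      Real.log (G y) = -sinkhornPotential K p q y := fun {y} hy => by
    rw [Real.log_mul (Finset.prod_pos fun j _ => Real.rpow_pos_of_pos (hy j) _).ne'
      (Finset.prod_pos fun i _ => Real.rpow_pos_of_pos (hrow hy i) _).ne',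
      Real.log_prod fun j _ => (Real.rpow_pos_of_pos (hy j) _).ne',
      Real.log_prod fun i _ => (Real.rpow_pos_of_pos (hrow hy i) _).ne']
    simp only [Real.log_rpow (hy _), Real.log_rpow (hrow hy _), neg_mul, Finset.sum_neg_distrib,
      sinkhornPotential]
    ring
  have hsum : ∀ {y : Fin n → ℝ}, (∀ j, 0 < y j) → 0 < ∑ j, y j := fun hy =>
    Finset.sum_pos (fun j _ => hy j) Finset.univ_nonempty
  obtain ⟨x, hxmem, hxmax⟩ := (isCompact_stdSimplex ℝ (Fin n)).exists_isMaxOn ⟨q, hq⟩ hGcont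
  have hxpos : ∀ j, 0 < x j := fun j => by
    refine (hxmem.1 j).lt_of_ne' fun h => ?_
    have hzero : G x = 0 := mul_eq_zero_of_left
      (Finset.prod_eq_zero (Finset.mem_univ j) (by rw [h, Real.zero_rpow (hqpos j).ne'])) _
    have hle : G q ≤ G x := hxmax hq
    exact absurd (hGpos hqpos) (by linarith)
  refine ⟨x, hxpos, fun y hy => ?_⟩
  have hs := inv_pos.mpr (hsum hy)
  have hzpos : ∀ j, 0 < ((∑ k, y k)⁻¹ • y) j := fun j => mul_pos hs (hy j)
  have hzmem : (∑ k, y k)⁻¹ • y ∈ stdSimplex ℝ (Fin n) :=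
    ⟨fun j => (hzpos j).le, by
      simp only [Pi.smul_apply, smul_eq_mul, ← Finset.mul_sum]
      exact inv_mul_cancel₀ (hsum hy).ne'⟩
  have hle : Real.log (G ((∑ k, y k)⁻¹ • y)) ≤ Real.log (G x) :=
    Real.log_le_log (hGpos hzpos) (hxmax hzmem)
  rw [hGlog hzpos, hGlog hxpos, sinkhornPotential_smul hK hp hq hy hs] at hle
  linarith

lemma hasDerivAt_sinkhornPotential {n : ℕ} {K : Matrix (Fin n) (Fin n) ℝ} (p q : Fin n → ℝ)
    {x : Fin n → ℝ} (hx : ∀ j, x j ≠ 0) (hKx : ∀ i, ∑ j, K i j * x j ≠ 0) (v : Fin n → ℝ) :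
    HasDerivAt (fun t : ℝ => sinkhornPotential K p q (x + t • v))
      (∑ i, p i * ((∑ j, K i j * v j) / ∑ j, K i j * x j) - ∑ j, q j * (v j / x j)) 0 := by
  have hcoord : ∀ j, HasDerivAt (fun t : ℝ => (x + t • v) j) (v j) 0 := fun j => by
    simpa using ((hasDerivAt_id (0 : ℝ)).mul_const (v j)).const_add (x j)
  refine HasDerivAt.sub ?_ ?_
  · refine HasDerivAt.fun_sum fun i _ => HasDerivAt.const_mul _ ?_
    have h := (HasDerivAt.fun_sum (u := Finset.univ) fun j _ =>
      (hcoord j).const_mul (K i j)).log (by simpa using hKx i)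
    simpa using h
  · refine HasDerivAt.fun_sum fun j _ => HasDerivAt.const_mul _ ?_
    simpa using (hcoord j).log (by simpa using hx j)

/-- existence of Sinkhorn scalings: for entrywise-positive `K`
and strictly positive probability vectors `p, q`, there are entrywise-positive
vectors `a, b` such that `T_{ij} = a_i K_{ij} b_j` has row sums `p` and column
sums `q`, i.e. `T ∈ S(p,q)`. -/
theorem sinkhorn_scaling_exists {n : ℕ} (K : Matrix (Fin n) (Fin n) ℝ)
    (hKpos : ∀ i j, 0 < K i j) (p q : Fin n → ℝ)
    (hp : IsProbVec p) (hq : IsProbVec q)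
    (hppos : ∀ i, 0 < p i) (hqpos : ∀ j, 0 < q j) :
    ∃ a b : Fin n → ℝ, (∀ i, 0 < a i) ∧ (∀ j, 0 < b j) ∧
      (Matrix.of fun i j => a i * K i j * b j) ∈ transportPolytope p q := by
  have : NeZero n := ⟨by
    rintro rfl
    simpa using hp.2⟩
  obtain ⟨x, hx, hmin⟩ := exists_sinkhornPotential_le hKpos hp hq hqpos
  have hKx : ∀ i, 0 < ∑ j, K i j * x j := fun i =>
    Finset.sum_pos (fun j _ => mul_pos (hKpos i j) (hx j)) Finset.univ_nonempty
  refine ⟨fun i => p i / ∑ j, K i j * x j, x, fun i => div_pos (hppos i) (hKx i), hx,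
    fun i j => (mul_pos (mul_pos (div_pos (hppos i) (hKx i)) (hKpos i j)) (hx j)).le,
    fun i => ?_, fun j => ?_⟩
  · simp only [Matrix.of_apply, mul_assoc, ← Finset.mul_sum]
    exact div_mul_cancel₀ _ (hKx i).ne'
  · have hlocal : IsLocalMin
        (fun t : ℝ => sinkhornPotential K p q (x + t • Pi.single j (1 : ℝ))) 0 := by
      have hpos : ∀ᶠ t : ℝ in nhds 0, ∀ k, 0 < (x + t • (Pi.single j 1 : Fin n → ℝ)) k := by
        refine eventually_all.mpr fun k => ?_
        have hcont : Continuous fun t : ℝ => (x + t • (Pi.single j 1 : Fin n → ℝ)) k := by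
          simp only [Pi.add_apply, Pi.smul_apply]
          fun_prop
        exact hcont.continuousAt.eventually_const_lt (by simpa using hx k)
      filter_upwards [hpos] with t ht
      simpa using hmin _ ht
    have hcrit := hlocal.hasDerivAt_eq_zero
      (hasDerivAt_sinkhornPotential p q (fun k => (hx k).ne') (fun i => (hKx i).ne') _)
    have hright : ∑ k, q k * ((Pi.single j (1 : ℝ) : Fin n → ℝ) k / x k) = q j / x j := by
      rw [Finset.sum_eq_single j (fun k _ hk => by simp [hk]) (by simp)]
      simp [div_eq_mul_inv]
    have hleft : ∀ i, ∑ k, K i k * (Pi.single j (1 : ℝ) : Fin n → ℝ) k = K i j := fun i => by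
      rw [Finset.sum_eq_single j (fun k _ hk => by simp [hk]) (by simp)]
      simp
    simp only [hleft, hright] at hcrit
    simp only [Matrix.of_apply, ← Finset.sum_mul]
    rw [← eq_div_iff (hx j).ne', ← sub_eq_zero.mp hcrit]
    exact Finset.sum_congr rfl fun i _ => by ring
end

section
/- Let C ∈ ℝ^{n×n} and p, q ∈ P_n. For each ε > 0 let T*_ε denote the unique minimizer of J_ε over S(p,q). If (ε_k) is a sequence of positive reals with ε_k → 0 and T*_{ε_k} → T̄ for some matrix T̄, then T̄ ∈ S(p,q) and T̄ minimizes T ↦ ⟨C, T⟩ over S(p,q); that is, every limit point of the regularized solutions as ε → 0 is a solution of the unregularized optimal transport problem. -/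
open Matrix BigOperators Filter

theorem isClosed_transportPolytope {n : ℕ} (p q : Fin n → ℝ) :
    IsClosed (transportPolytope p q) := by
  have hentry (i j : Fin n) : Continuous fun T : Matrix (Fin n) (Fin n) ℝ => T i j :=
    continuous_id.matrix_elem i j
  simp only [transportPolytope, Set.ofPred_and, Set.ofPred_forall]
  refine .inter ?_ (.inter ?_ ?_)
  · exact isClosed_iInter fun i => isClosed_iInter fun j =>
      isClosed_le continuous_const (hentry i j)
  · exact isClosed_iInter fun i =>
      isClosed_eq (continuous_finsetSum _ fun j _ => hentry i j) continuous_const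
  · exact isClosed_iInter fun j =>
      isClosed_eq (continuous_finsetSum _ fun i _ => hentry i j) continuous_const

theorem continuous_entObj {n : ℕ} (C : Matrix (Fin n) (Fin n) ℝ) :
    Continuous fun x : ℝ × Matrix (Fin n) (Fin n) ℝ => entObj C x.1 x.2 := by
  have hentry (i j : Fin n) : Continuous fun x : ℝ × Matrix (Fin n) (Fin n) ℝ => x.2 i j :=
    continuous_snd.matrix_elem i j
  simp only [entObj, frobInner, mul_sub, mul_one]
  refine .add ?_ (continuous_fst.mul ?_)
  · exact continuous_finsetSum _ fun i _ => continuous_finsetSum _ fun j _ =>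
      continuous_const.mul (hentry i j)
  · exact continuous_finsetSum _ fun i _ => continuous_finsetSum _ fun j _ =>
      (Real.continuous_mul_log.comp (hentry i j)).sub (hentry i j)

theorem entObj_zero {n : ℕ} (C T : Matrix (Fin n) (Fin n) ℝ) :
    entObj C 0 T = frobInner C T := by
  simp [entObj]

/-- any limit point (along a sequence `ε_k → 0⁺`) of the
entropic minimizers `T*_ε` lies in `S(p,q)` and minimizes `⟨C,·⟩` there. -/
theorem entropic_limit_point_is_optimal {n : ℕ}
    (C : Matrix (Fin n) (Fin n) ℝ) (p q : Fin n → ℝ)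
    (hp : IsProbVec p) (hq : IsProbVec q)
    (Tstar : ℝ → Matrix (Fin n) (Fin n) ℝ)
    (hTstar : ∀ ε : ℝ, 0 < ε → Tstar ε ∈ transportPolytope p q ∧
      ∀ T ∈ transportPolytope p q, entObj C ε (Tstar ε) ≤ entObj C ε T)
    (εseq : ℕ → ℝ) (hεpos : ∀ k, 0 < εseq k)
    (hεlim : Tendsto εseq atTop (nhds 0))
    (Tbar : Matrix (Fin n) (Fin n) ℝ)
    (hTlim : Tendsto (fun k => Tstar (εseq k)) atTop (nhds Tbar)) :
    Tbar ∈ transportPolytope p q ∧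
      ∀ T ∈ transportPolytope p q, frobInner C Tbar ≤ frobInner C T := by
  refine ⟨(isClosed_transportPolytope p q).mem_of_tendsto hTlim
    (.of_forall fun k => (hTstar _ (hεpos k)).1), fun T hT => ?_⟩
  have hstar := ((continuous_entObj C).tendsto (0, Tbar)).comp (hεlim.prodMk_nhds hTlim)
  have hconst := ((continuous_entObj C).tendsto (0, T)).comp
    (hεlim.prodMk_nhds tendsto_const_nhds)
  simpa only [entObj_zero] using
    le_of_tendsto_of_tendsto' hstar hconst fun k => (hTstar _ (hεpos k)).2 T hT
end

section
/- Let C ∈ ℝ^{n×n} and p, q ∈ P_n. For each ε > 0 let T*_ε denote the unique minimizer of J_ε over S(p,q). Then the optimal transport cost of the regularized solutions converges to the optimal value of the unregularized problem: ⟨C, T*_ε⟩ → min_{T ∈ S(p,q)} ⟨C, T⟩ as ε → 0⁺. -/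
open Matrix BigOperators Filter

theorem neg_one_le_mul_log_sub_one {x : ℝ} (hx : 0 ≤ x) : -1 ≤ x * (Real.log x - 1) := by
  rcases hx.eq_or_lt with rfl | hx
  · simp
  · have h := mul_le_mul_of_nonneg_left (Real.one_sub_inv_le_log_of_pos hx) hx.le
    rw [mul_sub, mul_inv_cancel₀ hx.ne'] at h
    linarith

theorem mul_log_sub_one_nonpos {x : ℝ} (h0 : 0 ≤ x) (h1 : x ≤ 1) :
    x * (Real.log x - 1) ≤ 0 :=
  mul_nonpos_of_nonneg_of_nonpos h0 (by linarith [Real.log_nonpos h0 h1])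

theorem le_one_of_mem_transportPolytope {n : ℕ} {p q : Fin n → ℝ} (hp : IsProbVec p)
    {T : Matrix (Fin n) (Fin n) ℝ} (hT : T ∈ transportPolytope p q) (i j : Fin n) :
    T i j ≤ 1 := by
  calc T i j ≤ ∑ k, T i k :=
        Finset.single_le_sum (fun k _ => hT.1 i k) (Finset.mem_univ j)
    _ = p i := hT.2.1 i
    _ ≤ ∑ k, p k := Finset.single_le_sum (fun k _ => hp.1 k) (Finset.mem_univ i)
    _ = 1 := hp.2

theorem entObj_le_frobInner {n : ℕ} {p q : Fin n → ℝ} (hp : IsProbVec p)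
    (C : Matrix (Fin n) (Fin n) ℝ) {ε : ℝ} (hε : 0 ≤ ε)
    {T : Matrix (Fin n) (Fin n) ℝ} (hT : T ∈ transportPolytope p q) :
    entObj C ε T ≤ frobInner C T :=
  add_le_of_nonpos_right <| mul_nonpos_of_nonneg_of_nonpos hε <|
    Finset.sum_nonpos fun i _ => Finset.sum_nonpos fun j _ =>
      mul_log_sub_one_nonpos (hT.1 i j) (le_one_of_mem_transportPolytope hp hT i j)

theorem frobInner_le_entObj_add {n : ℕ} (C : Matrix (Fin n) (Fin n) ℝ) {ε : ℝ} (hε : 0 ≤ ε)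
    {T : Matrix (Fin n) (Fin n) ℝ} (hT : ∀ i j, 0 ≤ T i j) :
    frobInner C T ≤ entObj C ε T + ε * (n * n) := by
  have h : ∑ _i : Fin n, ∑ _j : Fin n, (-1 : ℝ) ≤ ∑ i, ∑ j, T i j * (Real.log (T i j) - 1) :=
    Finset.sum_le_sum fun i _ => Finset.sum_le_sum fun j _ => neg_one_le_mul_log_sub_one (hT i j)
  have h' := mul_le_mul_of_nonneg_left h hε
  simp only [Finset.sum_const, Finset.card_univ, Fintype.card_fin, nsmul_eq_mul] at h'
  unfold entObj
  linarith

/-- the transport cost of the entropic minimizers converges to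
the optimal value of the unregularized problem as `ε → 0⁺`. -/
theorem entropic_cost_tendsto_optimal_value {n : ℕ}
    (C : Matrix (Fin n) (Fin n) ℝ) (p q : Fin n → ℝ)
    (hp : IsProbVec p) (hq : IsProbVec q)
    (Tstar : ℝ → Matrix (Fin n) (Fin n) ℝ)
    (hTstar : ∀ ε : ℝ, 0 < ε → Tstar ε ∈ transportPolytope p q ∧
      ∀ T ∈ transportPolytope p q, entObj C ε (Tstar ε) ≤ entObj C ε T)
    (m : ℝ)
    (hm : IsLeast ((fun T => frobInner C T) '' transportPolytope p q) m) :
    Tendsto (fun ε => frobInner C (Tstar ε))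
      (nhdsWithin 0 (Set.Ioi (0 : ℝ))) (nhds m) := by
  obtain ⟨⟨T₀, hT₀, rfl⟩, hle⟩ := hm
  have hlim : Tendsto (fun ε : ℝ => frobInner C T₀ + ε * (n * n))
      (nhdsWithin 0 (Set.Ioi 0)) (nhds (frobInner C T₀)) := by
    have h : Continuous fun ε : ℝ => frobInner C T₀ + ε * (n * n) := by fun_prop
    simpa using (h.tendsto 0).mono_left nhdsWithin_le_nhds
  refine tendsto_of_tendsto_of_tendsto_of_le_of_le' tendsto_const_nhds hlim ?_ ?_
  · filter_upwards [self_mem_nhdsWithin] with ε hε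
    exact hle ⟨Tstar ε, (hTstar ε hε).1, rfl⟩
  · filter_upwards [self_mem_nhdsWithin] with ε hε
    obtain ⟨hmem, hmin⟩ := hTstar ε hε
    have hε' : 0 ≤ ε := le_of_lt hε
    linarith [hmin T₀ hT₀, entObj_le_frobInner hp C hε' hT₀,
      frobInner_le_entObj_add C hε' hmem.1]
end
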